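/- Let n ≥ 2 and let a = (a₁,…,aₙ) ∈ ℂⁿ with Σ_{k} a_k² = 0 and a_i ≠ 0 for all i. On U = {u ∈ ℝⁿ : τ₀(u) ≠ 0}, with τ₀(u) = Σ_{k} a_k²u_k, define γ_{jk} = −a_j a_k/τ₀, ψ_{i1} = −a_i/τ₀, H_j = (1/2)·Σ_{k≠j} γ_{jk}²·(u_j − u_k), and J = ψ_{11}ψ_{21}⋯ψ_{n1}. Then for every j = 1,…,n: H_j − (1/24)·(∂J/∂u_j)/J = ((n−12)/24)·(∂τ₀/∂u_j)/τ₀. Equivalently, the G-function G = log(τ_I/J^{1/24}), with d log τ_I = Σ_j H_j du_j, satisfies dG = ((n−12)/24)·d log τ₀ = ((12−n)/24)·d log tⁿ, i.e. G(t) = ((12−n)/24)·log(tⁿ) up to an additive constant, where tⁿ = −1/τ₀. -/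

import Mathlib

open Matrix Finset

/-- Partial derivative `∂f/∂u_k` of a function on `ℝⁿ`. -/
noncomputable def pd {n : ℕ} {E : Type*} [NormedAddCommGroup E] [NormedSpace ℝ E]
    (k : Fin n) (f : (Fin n → ℝ) → E) (u : Fin n → ℝ) : E :=
  fderiv ℝ f u (Pi.single k 1)

/-- `τ₀(u) = Σ_k a_k² u_k`. -/
noncomputable def tau0 {n : ℕ} (a : Fin n → ℂ) (u : Fin n → ℝ) : ℂ :=
  ∑ k, (a k) ^ 2 * (u k : ℂ)

/-- The rotation coefficients `γ_{jk} = −a_j a_k / τ₀`. -/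
noncomputable def gam {n : ℕ} (a : Fin n → ℂ) (j k : Fin n) (u : Fin n → ℝ) : ℂ :=
  -(a j * a k) / tau0 a u

/-- `ψ_{i1} = −a_i/τ₀`. -/
noncomputable def psi1 {n : ℕ} (a : Fin n → ℂ) (i : Fin n) (u : Fin n → ℝ) : ℂ :=
  -(a i) / tau0 a u

/-- The Jacobian `J = ψ_{11}ψ_{21}⋯ψ_{n1}`. -/
noncomputable def Jfun {n : ℕ} (a : Fin n → ℂ) (u : Fin n → ℝ) : ℂ :=
  ∏ i, psi1 a i u

theorem hasFDerivAt_tau0 {n : ℕ} (a : Fin n → ℂ) (u : Fin n → ℝ) :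
    HasFDerivAt (tau0 a)
      (∑ k, (a k) ^ 2 • Complex.ofRealCLM.comp
        (ContinuousLinearMap.proj (R := ℝ) (φ := fun _ : Fin n => ℝ) k)) u := by
  unfold tau0
  refine HasFDerivAt.fun_sum fun k _ => ?_
  exact (Complex.ofRealCLM.comp (ContinuousLinearMap.proj (R := ℝ)
    (φ := fun _ : Fin n => ℝ) k)).hasFDerivAt.const_mul _

theorem pd_tau0 {n : ℕ} (a : Fin n → ℂ) (j : Fin n) (u : Fin n → ℝ) :
    pd j (tau0 a) u = (a j) ^ 2 := by
  simp [pd, (hasFDerivAt_tau0 a u).fderiv, Pi.single_apply,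
    apply_ite]

theorem Jfun_eq {n : ℕ} (a : Fin n → ℂ) (u : Fin n → ℝ) :
    Jfun a u = (∏ i, -(a i)) * ((tau0 a u) ^ n)⁻¹ := by
  simp [Jfun, psi1, Finset.prod_div_distrib, div_eq_mul_inv (∏ i, -(a i))]

theorem pd_comp {n : ℕ} {f : (Fin n → ℝ) → ℂ} {g : ℂ → ℂ} {g' : ℂ} {u : Fin n → ℝ}
    (j : Fin n) (hg : HasDerivAt g g' (f u)) (hf : DifferentiableAt ℝ f u) :
    pd j (fun v => g (f v)) u = g' * pd j f u := by
  have h := (hg.hasFDerivAt.restrictScalars ℝ).comp u hf.hasFDerivAt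
  unfold pd
  rw [show (fun v => g (f v)) = g ∘ f from rfl, h.fderiv]
  simp [mul_comm]

/-- The logarithmic derivative of the Jacobian is `-n` times that of `τ₀`. -/
theorem pd_Jfun_div {n : ℕ} (a : Fin n → ℂ) (hne : ∀ i, a i ≠ 0) (j : Fin n)
    {u : Fin n → ℝ} (hu : tau0 a u ≠ 0) :
    pd j (Jfun a) u / Jfun a u = -(n : ℂ) * (a j) ^ 2 / tau0 a u := by
  have hprod : (∏ i, -(a i)) ≠ 0 :=
    Finset.prod_ne_zero_iff.mpr fun i _ => neg_ne_zero.mpr (hne i)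
  have hg := ((hasDerivAt_pow n (tau0 a u)).inv (pow_ne_zero n hu)).const_mul (∏ i, -(a i))
  have h := pd_comp j hg (hasFDerivAt_tau0 a u).differentiableAt
  have hJ : Jfun a = fun v => (∏ i, -(a i)) * ((tau0 a v) ^ n)⁻¹ := funext (Jfun_eq a)
  obtain ⟨m, rfl⟩ : ∃ m, n = m + 1 := ⟨n - 1, by have := j.pos; omega⟩
  simp only [Pi.inv_apply] at h
  rw [hJ, h, pd_tau0]
  simp only [Nat.add_sub_cancel]
  field_simp
  ring

/-- When `a` is isotropic, the sum in the quadratic Hamiltonian `H_j` is `-a_j² / τ₀`. -/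
theorem sum_gam_sq_mul_sub {n : ℕ} (a : Fin n → ℂ) (hiso : ∑ k, (a k) ^ 2 = 0)
    (j : Fin n) {u : Fin n → ℝ} (hu : tau0 a u ≠ 0) :
    ∑ k ∈ Finset.univ.erase j, (gam a j k u) ^ 2 * ((u j : ℂ) - (u k : ℂ))
      = -(a j) ^ 2 / tau0 a u := by
  rw [Finset.sum_erase _ (by simp)]
  calc ∑ k, (gam a j k u) ^ 2 * ((u j : ℂ) - (u k : ℂ))
      = (a j) ^ 2 / (tau0 a u) ^ 2 * ((∑ k, (a k) ^ 2) * u j - tau0 a u) := by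
        conv_rhs => rw [Finset.sum_mul]; arg 2; arg 2; unfold tau0
        rw [← Finset.sum_sub_distrib, Finset.mul_sum]
        refine Finset.sum_congr rfl fun k _ => ?_
        unfold gam
        ring
    _ = -(a j) ^ 2 / tau0 a u := by
        rw [hiso]
        field_simp
        ring

/-- For the example Frobenius manifold the G-function is `((12−n)/24)·log tⁿ`:
with `H_j = (1/2)Σ_{k≠j}γ_{jk}²(u_j − u_k)` and `J = ψ_{11}⋯ψ_{n1}` one has
`H_j − (1/24)(∂J/∂u_j)/J = ((n−12)/24)(∂τ₀/∂u_j)/τ₀`. -/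
theorem example_G_function
    (n : ℕ) (hn : 2 ≤ n) (a : Fin n → ℂ) (hiso : ∑ k, (a k) ^ 2 = 0)
    (hne : ∀ i, a i ≠ 0) :
    ∀ u : Fin n → ℝ, tau0 a u ≠ 0 → ∀ j : Fin n,
      (1/2 : ℂ) * (∑ k ∈ Finset.univ.erase j, (gam a j k u) ^ 2 * ((u j : ℂ) - (u k : ℂ)))
          - (1/24 : ℂ) * pd j (Jfun a) u / Jfun a u
        = (((n : ℂ) - 12) / 24) * pd j (tau0 a) u / tau0 a u := by
  intro u hu j
  rw [sum_gam_sq_mul_sub a hiso j hu, mul_div_assoc (1 / 24 : ℂ), pd_Jfun_div a hne j hu, pd_tau0]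
  ring
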